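/- arXiv:1709.08496 — 3 statements merged into one kernel-verified Lean document; each statement's English description precedes it below -/
import Mathlib

section
/- There exists a constant C > 0, depending only on T, such that for every Δt ∈ (0,T]: Σ_{k=1}^∞ (1 − e^{−2k²π²Δt})² / (k²π²) ≤ C·√Δt. -/
open Real

/-- The Dirichlet eigenvalues `λ_k = kπ` (indexed so that `lam k` is `λ_{k+1}`). -/
noncomputable def lam (k : ℕ) : ℝ := (k + 1) * Real.pi

theorem one_sub_exp_neg_sq_div_le {x : ℝ} (hx : 0 < x) :
    (1 - Real.exp (-2 * x)) ^ 2 / x ≤ 3 / (1 + x) := by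
  have h_exp_le : Real.exp (-2 * x) ≤ 1 := Real.exp_le_one_iff.mpr (by linarith)
  have h_exp_pos := Real.exp_pos (-2 * x)
  have h_le_exp := Real.add_one_le_exp (-2 * x)
  have h_le_one : (1 - Real.exp (-2 * x)) ^ 2 ≤ 1 := by nlinarith
  have h_le_two_mul : (1 - Real.exp (-2 * x)) ^ 2 ≤ 2 * x := by nlinarith
  rw [div_le_div_iff₀ hx (by linarith)]
  nlinarith

theorem sq_div_one_add_sq_le_telescope {s : ℝ} (hs : 0 < s) (k : ℕ) :
    s ^ 2 / (1 + (s * (k + 1)) ^ 2) ≤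
      2 * s * (1 / (1 + s * k) - 1 / (1 + s * ((k + 1 : ℕ) : ℝ))) := by
  have hk : 0 ≤ s * k := by positivity
  have h_eq : 2 * s * (1 / (1 + s * k) - 1 / (1 + s * ((k + 1 : ℕ) : ℝ))) =
      2 * s ^ 2 / ((1 + s * k) * (1 + s * (k + 1))) := by
    push_cast
    field_simp
    ring
  rw [h_eq, div_le_div_iff₀ (by positivity) (by positivity)]
  have h_prod : (1 + s * k) * (1 + s * (k + 1)) ≤ 2 * (1 + (s * (k + 1)) ^ 2) := by
    nlinarith [sq_nonneg (1 - s * (k + 1))]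
  nlinarith [mul_le_mul_of_nonneg_left h_prod (sq_nonneg s)]

theorem one_sub_exp_lam_sq_div_le {t : ℝ} (ht : 0 < t) (k : ℕ) :
    (1 - Real.exp (-2 * lam k ^ 2 * t)) ^ 2 / lam k ^ 2 ≤
      6 * √t * (1 / (1 + √t * k) - 1 / (1 + √t * ((k + 1 : ℕ) : ℝ))) := by
  have h_lam : (k : ℝ) + 1 ≤ lam k :=
    le_mul_of_one_le_right (by positivity) (by linarith [Real.pi_gt_three])
  have h_lam_pos : 0 < lam k := lt_of_lt_of_le (by positivity) h_lam
  have h_sq : √t ^ 2 = t := Real.sq_sqrt ht.le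
  calc (1 - Real.exp (-2 * lam k ^ 2 * t)) ^ 2 / lam k ^ 2
      = t * ((1 - Real.exp (-2 * (lam k ^ 2 * t))) ^ 2 / (lam k ^ 2 * t)) := by
        rw [← mul_assoc]
        field_simp
    _ ≤ t * (3 / (1 + lam k ^ 2 * t)) := by
        exact mul_le_mul_of_nonneg_left (one_sub_exp_neg_sq_div_le (by positivity)) ht.le
    _ ≤ t * (3 / (1 + (k + 1 : ℝ) ^ 2 * t)) := by gcongr
    _ = 3 * (√t ^ 2 / (1 + (√t * (k + 1)) ^ 2)) := by
        rw [mul_pow, h_sq]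
        ring
    _ ≤ 3 * (2 * √t * (1 / (1 + √t * k) - 1 / (1 + √t * ((k + 1 : ℕ) : ℝ)))) := by
        gcongr
        exact sq_div_one_add_sq_le_telescope (Real.sqrt_pos.mpr ht) k
    _ = _ := by ring

/-- `Σ_{k=1}^∞ (1 − e^{−2k²π²Δt})²/(k²π²) ≤ C √Δt` for `Δt ∈ (0,T]`. -/
theorem stmt6 (T : ℝ) (hT : 0 < T) :
    ∃ C : ℝ, 0 < C ∧
      ∀ Δt ∈ Set.Ioc (0 : ℝ) T,
        ∑' k, (1 - Real.exp (-2 * lam k ^ 2 * Δt)) ^ 2 / lam k ^ 2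
          ≤ C * Real.sqrt Δt := by
  refine ⟨6, by norm_num, fun Δt hΔt => ?_⟩
  refine Real.tsum_le_of_sum_range_le (fun k => by positivity) fun n => ?_
  refine (Finset.sum_le_sum fun k _ => one_sub_exp_lam_sq_div_le hΔt.1 k).trans ?_
  rw [← Finset.mul_sum, Finset.sum_range_sub' (fun k : ℕ => 1 / (1 + √Δt * (k : ℝ)))]
  refine mul_le_of_le_one_right (by positivity) ?_
  have h_last : 0 ≤ 1 / (1 + √Δt * (n : ℝ)) := by positivity
  simpa using h_last
end

section
/- There exists a constant C > 0, depending only on T, such that for every Δt ∈ (0,T]: (1/Δt) · Σ_{k=1}^∞ (1 − e^{−k²π²Δt})² / (k⁴π⁴) ≤ C·√Δt. -/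
open Real

lemma one_sub_exp_neg_sq_mul_one_add_le {z : ℝ} (hz : 0 ≤ z) :
    (1 - Real.exp (-z ^ 2)) * (1 + z) ≤ 2 * z ^ 2 := by
  have hlin : 1 - Real.exp (-z ^ 2) ≤ z ^ 2 := by linarith [Real.add_one_le_exp (-z ^ 2)]
  have hone : 1 - Real.exp (-z ^ 2) ≤ 1 := by linarith [Real.exp_pos (-z ^ 2)]
  rcases le_total z 1 with h | h
  · nlinarith [mul_le_mul_of_nonneg_right hlin (by linarith : 0 ≤ 1 + z), sq_nonneg z]
  · nlinarith [mul_le_mul_of_nonneg_right hone (by linarith : 0 ≤ 1 + z)]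

lemma add_one_le_lam (k : ℕ) : (k : ℝ) + 1 ≤ lam k :=
  le_mul_of_one_le_right (by positivity) (by linarith [Real.pi_gt_three])

lemma lam_pos (k : ℕ) : 0 < lam k := by
  unfold lam
  positivity

lemma summand_le_telescoping {s : ℝ} (hs : 0 < s) (k : ℕ) :
    (1 - Real.exp (-(lam k ^ 2) * s ^ 2)) ^ 2 / lam k ^ 4
      ≤ 4 * s ^ 3 * (1 / (1 + k * s)) - 4 * s ^ 3 * (1 / (1 + (k + 1 : ℕ) * s)) := by
  have hl := lam_pos k
  set u := 1 - Real.exp (-(lam k ^ 2) * s ^ 2) with hu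
  have hu0 : 0 ≤ u := by
    have : Real.exp (-(lam k ^ 2) * s ^ 2) ≤ 1 :=
      Real.exp_le_one_iff.2 (by nlinarith [mul_pos (pow_pos hl 2) (pow_pos hs 2)])
    linarith
  have hk : ((k : ℝ) + 1) * s ≤ lam k * s := mul_le_mul_of_nonneg_right (add_one_le_lam k) hs.le
  have hmain : u * (1 + (k + 1) * s) ≤ 2 * s ^ 2 * lam k ^ 2 := by
    have h := one_sub_exp_neg_sq_mul_one_add_le (mul_pos hl hs).le
    rw [show -(lam k * s) ^ 2 = -(lam k ^ 2) * s ^ 2 by ring, ← hu] at h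
    calc u * (1 + (k + 1) * s) ≤ u * (1 + lam k * s) := by gcongr
      _ ≤ 2 * (lam k * s) ^ 2 := h
      _ = 2 * s ^ 2 * lam k ^ 2 := by ring
  have hdiff : 4 * s ^ 3 * (1 / (1 + k * s)) - 4 * s ^ 3 * (1 / (1 + (k + 1 : ℕ) * s))
      = 4 * s ^ 4 / ((1 + k * s) * (1 + (k + 1) * s)) := by
    have h₁ : (1 + k * s : ℝ) ≠ 0 := by positivity
    have h₂ : (1 + (k + 1) * s : ℝ) ≠ 0 := by positivity
    push_cast
    field_simp
    ring
  calc u ^ 2 / lam k ^ 4 ≤ 4 * s ^ 4 / (1 + (k + 1) * s) ^ 2 := by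
        rw [div_le_div_iff₀ (by positivity) (by positivity)]
        calc u ^ 2 * (1 + (k + 1) * s) ^ 2 = (u * (1 + (k + 1) * s)) ^ 2 := by ring
          _ ≤ (2 * s ^ 2 * lam k ^ 2) ^ 2 := by gcongr
          _ = 4 * s ^ 4 * lam k ^ 4 := by ring
    _ ≤ 4 * s ^ 4 / ((1 + k * s) * (1 + (k + 1) * s)) := by
        rw [sq (1 + ((k : ℝ) + 1) * s)]
        gcongr
        linarith
    _ = _ := hdiff.symm

lemma tsum_le_four_mul_cube {s : ℝ} (hs : 0 < s) :
    ∑' k, (1 - Real.exp (-(lam k ^ 2) * s ^ 2)) ^ 2 / lam k ^ 4 ≤ 4 * s ^ 3 := by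
  refine Real.tsum_le_of_sum_range_le (fun k => by positivity) fun n => ?_
  refine (Finset.sum_le_sum fun k _ => summand_le_telescoping hs k).trans ?_
  rw [Finset.sum_range_sub' (fun k : ℕ => 4 * s ^ 3 * (1 / (1 + k * s)))]
  have : 0 ≤ 4 * s ^ 3 * (1 / (1 + n * s)) := by positivity
  simpa using this

/-- `(1/Δt) Σ_{k=1}^∞ (1 − e^{−k²π²Δt})²/(k⁴π⁴) ≤ C √Δt` for `Δt ∈ (0,T]`. -/
theorem stmt7 (T : ℝ) (hT : 0 < T) :
    ∃ C : ℝ, 0 < C ∧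
      ∀ Δt ∈ Set.Ioc (0 : ℝ) T,
        (1 / Δt) * ∑' k, (1 - Real.exp (-(lam k ^ 2) * Δt)) ^ 2 / lam k ^ 4
          ≤ C * Real.sqrt Δt := by
  refine ⟨4, by norm_num, fun Δt hΔt => ?_⟩
  have hs : 0 < √Δt := Real.sqrt_pos.2 hΔt.1
  have h := tsum_le_four_mul_cube hs
  rw [Real.sq_sqrt hΔt.1.le] at h
  rw [one_div, inv_mul_le_iff₀ hΔt.1]
  calc _ ≤ 4 * √Δt ^ 3 := h
    _ = √Δt ^ 2 * (4 * √Δt) := by ring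
    _ = Δt * (4 * √Δt) := by rw [Real.sq_sqrt hΔt.1.le]
end

section
/- Fix T > 0, N* ∈ ℕ, Δt := T/N*, t_n := nΔt, T_n := (t_{n−1}, t_n). Let t ∈ (0,T], let N(t) ∈ {1,…,N*} be the unique index with t ∈ (t_{N(t)−1}, t_{N(t)}], and let k ∈ ℕ, k ≥ 1. Define Ψ_{N(t)}^k := Δt^{−2} · ∫_{T_{N(t)}} ( ∫_{T_{N(t)}} ( χ_{(0,t)}(s)·e^{−λ_k²(t−s)} − χ_{(0,t)}(s')·e^{−λ_k²(t−s')} ) ds' )² ds. Then Ψ_{N(t)}^k ≤ 5·(1 − e^{−2λ_k²Δt})²/λ_k² + Δt^{−1}·(1 − e^{−λ_k²Δt})²/λ_k⁴. -/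
open Real

/-- `Ψ_n^k = Δt⁻² ∫_{T_n} (∫_{T_n} (χ_{(0,t)}(s)e^{−λ_k²(t−s)}
  − χ_{(0,t)}(s')e^{−λ_k²(t−s')}) ds')² ds`. -/
noncomputable def Psi (Δt t : ℝ) (n k : ℕ) : ℝ :=
  (1 / Δt ^ 2) *
    ∫ s in (((n : ℝ) - 1) * Δt)..((n : ℝ) * Δt),
      (∫ s' in (((n : ℝ) - 1) * Δt)..((n : ℝ) * Δt),
        ((if s ∈ Set.Ioo 0 t then Real.exp (-(lam k ^ 2) * (t - s)) else 0)
          - (if s' ∈ Set.Ioo 0 t then Real.exp (-(lam k ^ 2) * (t - s')) else 0))) ^ 2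

theorem sq_exp_mul (c x : ℝ) : Real.exp (-c * x) ^ 2 = Real.exp (-(2 * c) * x) := by
  rw [← Real.exp_nat_mul]; congr 1; push_cast; ring

theorem integral_sq_integral_sub {f : ℝ → ℝ} {a b : ℝ}
    (hf : IntervalIntegrable f MeasureTheory.volume a b)
    (hf2 : IntervalIntegrable (fun s => f s ^ 2) MeasureTheory.volume a b) :
    ∫ s in a..b, (∫ s' in a..b, (f s - f s')) ^ 2
      = (b - a) ^ 2 * (∫ s in a..b, f s ^ 2) - (b - a) * (∫ s in a..b, f s) ^ 2 := by
  have inner (s : ℝ) : (∫ s' in a..b, (f s - f s')) ^ 2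
      = (b - a) ^ 2 * f s ^ 2 - 2 * (b - a) * (∫ s in a..b, f s) * f s
        + (∫ s in a..b, f s) ^ 2 := by
    rw [intervalIntegral.integral_sub intervalIntegrable_const hf,
      intervalIntegral.integral_const, smul_eq_mul]
    ring
  simp_rw [inner]
  rw [intervalIntegral.integral_add ((hf2.const_mul _).sub (hf.const_mul _))
      intervalIntegrable_const,
    intervalIntegral.integral_sub (hf2.const_mul _) (hf.const_mul _),
    intervalIntegral.integral_const_mul, intervalIntegral.integral_const_mul,
    intervalIntegral.integral_const, smul_eq_mul]
  ring

theorem integral_exp_neg_mul_sub {c : ℝ} (hc : c ≠ 0) (a t : ℝ) :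
    ∫ s in a..t, Real.exp (-c * (t - s)) = (1 - Real.exp (-c * (t - a))) / c := by
  have h (s : ℝ) : HasDerivAt (fun s => Real.exp (-c * (t - s)) / c)
      (Real.exp (-c * (t - s))) s := by
    have := ((((hasDerivAt_id s).const_sub t).const_mul (-c)).exp).div_const c
    refine this.congr_deriv ?_
    simp [hc]
  rw [intervalIntegral.integral_eq_sub_of_hasDerivAt (fun s _ => h s)
    (Continuous.intervalIntegrable (by fun_prop) _ _)]
  simp [sub_div]

theorem ite_Ioo_integral {g : ℝ → ℝ} (hg : Continuous g) {a t b : ℝ} (ha : 0 ≤ a)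
    (hat : a ≤ t) (htb : t ≤ b) :
    IntervalIntegrable (fun s => if s ∈ Set.Ioo 0 t then g s else 0) MeasureTheory.volume a b ∧
      ∫ s in a..b, (if s ∈ Set.Ioo 0 t then g s else 0) = ∫ s in a..t, g s := by
  have hl : Set.EqOn g (fun s => if s ∈ Set.Ioo 0 t then g s else 0) (Set.uIoo a t) := by
    intro s hs
    rw [Set.uIoo_of_le hat] at hs
    exact (if_pos ⟨ha.trans_lt hs.1, hs.2⟩).symm
  have hr : Set.EqOn (fun _ => (0 : ℝ)) (fun s => if s ∈ Set.Ioo 0 t then g s else 0)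
      (Set.uIoo t b) := by
    intro s hs
    rw [Set.uIoo_of_le htb] at hs
    exact (if_neg fun h => lt_asymm h.2 hs.1).symm
  have il := (hg.intervalIntegrable (μ := MeasureTheory.volume) a t).congr_uIoo hl
  have ir := (intervalIntegrable_const (μ := MeasureTheory.volume) (a := t) (b := b)).congr_uIoo hr
  refine ⟨il.trans ir, ?_⟩
  rw [← intervalIntegral.integral_add_adjacent_intervals il ir,
    ← intervalIntegral.integral_congr_uIoo hl, ← intervalIntegral.integral_congr_uIoo hr]
  simp

theorem variance_exp_bound {x : ℝ} (hx : 0 < x) (y : ℝ) :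
    (1 - Real.exp (-y) ^ 2) / 2 - (1 - Real.exp (-y)) ^ 2 / x
      ≤ 5 * (1 - Real.exp (-x) ^ 2) ^ 2 + (1 - Real.exp (-x)) ^ 2 / x := by
  have hE : Real.exp (-x) ≤ 1 / (1 + x) := by
    rw [Real.exp_neg, ← one_div]
    exact one_div_le_one_div_of_le (by linarith) (by linarith [Real.add_one_le_exp x])
  have hv : x / (1 + x) ≤ 1 - Real.exp (-x) := by
    have : x / (1 + x) = 1 - 1 / (1 + x) := by field_simp; ring
    linarith
  have hE0 := Real.exp_pos (-x)
  have hE1 : Real.exp (-x) ≤ 1 := Real.exp_le_one_iff.2 (by linarith)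
  generalize Real.exp (-x) = E at *
  generalize Real.exp (-y) = F
  rcases le_total x 1 with h | h
  · have h1 : (1 - F ^ 2) / 2 - (1 - F) ^ 2 / x ≤ x / 4 := by
      have : 0 ≤ ((1 - F) - x / 2) ^ 2 / x := by positivity
      have e : ((1 - F) - x / 2) ^ 2 / x = (1 - F) ^ 2 / x - (1 - F) + x / 4 := by
        field_simp; ring
      nlinarith [sq_nonneg (1 - F)]
    have h2 : x / 4 ≤ (1 - E) ^ 2 / x := by
      have : x / 2 ≤ 1 - E := le_trans (div_le_div_of_nonneg_left hx.le (by linarith) (by linarith)) hv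
      rw [le_div_iff₀ hx]; nlinarith
    have : 0 ≤ 5 * (1 - E ^ 2) ^ 2 := by positivity
    linarith
  · have h1 : 1 / 2 ≤ 1 - E := by
      refine le_trans ?_ hv
      rw [div_le_div_iff₀ (by norm_num) (by linarith)]; linarith
    have h2 : 1 / 2 ≤ 1 - E ^ 2 := by nlinarith
    have h3 : 0 ≤ (1 - F) ^ 2 / x := by positivity
    have h4 : 0 ≤ (1 - E) ^ 2 / x := by positivity
    nlinarith [sq_nonneg F]

/-- The last-interval contribution:
`Ψ_{N(t)}^k ≤ 5 (1 − e^{−2λ_k²Δt})²/λ_k² + Δt⁻¹ (1 − e^{−λ_k²Δt})²/λ_k⁴`. -/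
theorem stmt11 (T : ℝ) (hT : 0 < T) (Nstar : ℕ) (hN : 0 < Nstar)
    (t : ℝ) (ht : t ∈ Set.Ioc (0 : ℝ) T) (Nt : ℕ) (hNt : Nt ∈ Finset.Icc 1 Nstar)
    (htN : t ∈ Set.Ioc (((Nt : ℝ) - 1) * (T / Nstar)) ((Nt : ℝ) * (T / Nstar)))
    (k : ℕ) :
    Psi (T / Nstar) t Nt k
      ≤ 5 * (1 - Real.exp (-2 * lam k ^ 2 * (T / Nstar))) ^ 2 / lam k ^ 2
        + (1 / (T / Nstar)) *
            ((1 - Real.exp (-(lam k ^ 2) * (T / Nstar))) ^ 2 / lam k ^ 4) := by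
  have hΔ : 0 < T / Nstar := div_pos hT (by exact_mod_cast hN)
  have hN1 : (1 : ℝ) ≤ Nt := by exact_mod_cast (Finset.mem_Icc.1 hNt).1
  have hlam : 0 < lam k := mul_pos (by positivity) Real.pi_pos
  have h4 : lam k ^ 4 = (lam k ^ 2) ^ 2 := by ring
  have hc : 0 < lam k ^ 2 := by positivity
  rw [Psi, h4]
  generalize lam k ^ 2 = c at *
  generalize T / (Nstar : ℝ) = d at *
  have hlen : (Nt : ℝ) * d - (Nt - 1) * d = d := by ring
  have ha : 0 ≤ ((Nt : ℝ) - 1) * d := mul_nonneg (by linarith) hΔ.le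
  obtain ⟨hi, hI⟩ := ite_Ioo_integral (g := fun s => Real.exp (-c * (t - s)))
    (by fun_prop) ha htN.1.le htN.2
  obtain ⟨hi2, hI2⟩ := ite_Ioo_integral (g := fun s => Real.exp (-(2 * c) * (t - s)))
    (by fun_prop) ha htN.1.le htN.2
  have hsq (s : ℝ) : (if s ∈ Set.Ioo 0 t then Real.exp (-c * (t - s)) else 0) ^ 2
      = if s ∈ Set.Ioo 0 t then Real.exp (-(2 * c) * (t - s)) else 0 := by
    split_ifs
    · exact sq_exp_mul c _
    · simp
  rw [integral_sq_integral_sub hi (by simpa only [hsq] using hi2)]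
  simp only [hsq]
  rw [hI, hI2, integral_exp_neg_mul_sub hc.ne', integral_exp_neg_mul_sub (by positivity), hlen,
    ← sq_exp_mul, show -2 * c * d = -(2 * c) * d by ring, ← sq_exp_mul]
  have key := variance_exp_bound (mul_pos hc hΔ) (c * (t - (Nt - 1) * d))
  simp only [← neg_mul] at key
  generalize Real.exp (-c * (t - (Nt - 1) * d)) = F at *
  generalize Real.exp (-c * d) = E at *
  calc _ = ((1 - F ^ 2) / 2 - (1 - F) ^ 2 / (c * d)) / c := by field_simp
    _ ≤ (5 * (1 - E ^ 2) ^ 2 + (1 - E) ^ 2 / (c * d)) / c := by gcongr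
    _ = _ := by field_simp
end
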